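/- Let δ > 0. There exists a constant C > 0 (depending only on δ) such that for every sequence (a_k) of real numbers, sup_{R>0} |S̃_R^δ| ≤ C · sup_{N∈ℕ} |S_N^δ| + C · sup_{k≥0} |a_k|/(k+1)^δ, where the inequality is understood in [0,∞]. -/

import Mathlib

/-- The generalized binomial coefficient `A_k^δ = Γ(k+δ+1)/(Γ(k+1)·Γ(δ+1))`. -/
noncomputable def cesaroA (δ : ℝ) (k : ℕ) : ℝ :=
  Real.Gamma ((k : ℝ) + δ + 1) / (Real.Gamma ((k : ℝ) + 1) * Real.Gamma (δ + 1))

/-- The Cesàro (C,δ) mean `S_N^δ = (1/A_N^δ) Σ_{k=0}^N A_{N-k}^δ a_k`. -/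
noncomputable def cesaroMean (δ : ℝ) (a : ℕ → ℝ) (N : ℕ) : ℝ :=
  (1 / cesaroA δ N) * ∑ k ∈ Finset.range (N + 1), cesaroA δ (N - k) * a k

/-- The Riesz (R,δ) mean `S̃_R^δ = Σ_{k < R} (1 - k/R)^δ a_k`. -/
noncomputable def rieszMean (δ : ℝ) (a : ℕ → ℝ) (R : ℝ) : ℝ :=
  ∑ k ∈ Finset.range ⌈R⌉₊, if (k : ℝ) < R then (1 - (k : ℝ) / R) ^ δ * a k else 0

section

open Finset PowerSeries

/-- The formal power series `(1 - X) ^ r`. -/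
noncomputable def oneSubRpow (r : ℝ) : PowerSeries ℝ := evalNegHom (binomialSeries ℝ r)

lemma oneSubRpow_add (r s : ℝ) : oneSubRpow (r + s) = oneSubRpow r * oneSubRpow s := by
  simp [oneSubRpow]

lemma oneSubRpow_zero : oneSubRpow 0 = 1 := by
  simp [oneSubRpow]

lemma oneSubRpow_one : oneSubRpow 1 = 1 - X := by
  have h := binomialSeries_nat (R := ℝ) (A := ℝ) 1
  rw [Nat.cast_one, pow_one] at h
  rw [oneSubRpow, h, map_add, map_one, evalNegHom_X, sub_eq_add_neg]

lemma coeff_zero_oneSubRpow (r : ℝ) : coeff 0 (oneSubRpow r) = 1 := by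
  simp [oneSubRpow, evalNegHom]

lemma coeff_succ_oneSubRpow (r : ℝ) (k : ℕ) :
    ((k : ℝ) + 1) * coeff (k + 1) (oneSubRpow r) = (k - r) * coeff k (oneSubRpow r) := by
  have h := Ring.choose_smul_choose r (Nat.le_succ k)
  simp only [Nat.succ_eq_add_one, Nat.choose_succ_self_right, nsmul_eq_mul, Nat.cast_add,
    Nat.cast_one, Nat.add_sub_cancel_left, Ring.choose_one_right] at h
  simp only [oneSubRpow, evalNegHom, coeff_rescale, binomialSeries_coeff, smul_eq_mul, mul_one,
    pow_succ]
  linear_combination (-1) ^ k * (-1) * h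

lemma cesaroA_zero {δ : ℝ} (hδ : -1 < δ) : cesaroA δ 0 = 1 := by
  have : Real.Gamma (δ + 1) ≠ 0 := (Real.Gamma_pos_of_pos (by linarith)).ne'
  simp [cesaroA, this]

lemma cesaroA_succ {δ : ℝ} (hδ : -1 < δ) (k : ℕ) :
    ((k : ℝ) + 1) * cesaroA δ (k + 1) = (k + 1 + δ) * cesaroA δ k := by
  have hk : (0 : ℝ) ≤ k := k.cast_nonneg
  have h1 : Real.Gamma (δ + 1) ≠ 0 := (Real.Gamma_pos_of_pos (by linarith)).ne'
  have h2 : Real.Gamma ((k : ℝ) + 1) ≠ 0 := (Real.Gamma_pos_of_pos (by linarith)).ne'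
  have h3 : (k : ℝ) + 1 ≠ 0 := by positivity
  have h4 : (k : ℝ) + δ + 1 ≠ 0 := by linarith
  unfold cesaroA
  rw [Nat.cast_add, Nat.cast_one, show (k : ℝ) + 1 + δ + 1 = (k + δ + 1) + 1 by ring,
    Real.Gamma_add_one h4, Real.Gamma_add_one h3]
  field_simp
  ring

lemma cesaroA_pos {δ : ℝ} (hδ : -1 < δ) (k : ℕ) : 0 < cesaroA δ k := by
  have hk : (0 : ℝ) ≤ k := k.cast_nonneg
  exact div_pos (Real.Gamma_pos_of_pos (by linarith))
    (mul_pos (Real.Gamma_pos_of_pos (by linarith)) (Real.Gamma_pos_of_pos (by linarith)))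

lemma coeff_oneSubRpow_eq_cesaroA {δ : ℝ} (hδ : -1 < δ) (k : ℕ) :
    coeff k (oneSubRpow (-δ - 1)) = cesaroA δ k := by
  induction k with
  | zero => rw [coeff_zero_oneSubRpow, cesaroA_zero hδ]
  | succ k ih =>
    have hk : (k : ℝ) + 1 ≠ 0 := by positivity
    apply mul_left_cancel₀ hk
    rw [coeff_succ_oneSubRpow, cesaroA_succ hδ, ih]
    ring

lemma cesaroA_monotone {δ : ℝ} (hδ : 0 ≤ δ) : Monotone (cesaroA δ) := by
  refine monotone_nat_of_le_succ fun k => ?_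
  have h := cesaroA_succ (by linarith : -1 < δ) k
  have hp := cesaroA_pos (by linarith : -1 < δ) k
  have hk : (0 : ℝ) < (k : ℝ) + 1 := by positivity
  refine le_of_mul_le_mul_left ?_ hk
  rw [h]
  nlinarith

lemma cesaroA_le_rpow {δ : ℝ} (hδ : 0 ≤ δ) {n : ℕ} (hn : 1 ≤ n) :
    cesaroA δ n ≤ (1 + δ) * (n : ℝ) ^ δ := by
  induction n, hn using Nat.le_induction with
  | base =>
    have h := cesaroA_succ (by linarith : -1 < δ) 0
    rw [cesaroA_zero (by linarith)] at h
    norm_num at h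
    simp [h]
  | succ n hn ih =>
    have hn0 : (0 : ℝ) < n := by exact_mod_cast hn
    have hn1 : (0 : ℝ) < (n : ℝ) + 1 := by positivity
    have h := cesaroA_succ (by linarith : -1 < δ) n
    have hq : 1 + δ / (n + 1) ≤ (((n : ℝ) + 1) / n) ^ δ := by
      have hlog := Real.one_sub_inv_le_log_of_pos (by positivity : 0 < ((n : ℝ) + 1) / n)
      have he : 1 - (((n : ℝ) + 1) / n)⁻¹ = 1 / (n + 1) := by field_simp; ring
      rw [he] at hlog
      rw [Real.rpow_def_of_pos (by positivity)]
      have h1 := Real.add_one_le_exp (Real.log (((n : ℝ) + 1) / n) * δ)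
      have h2 := mul_le_mul_of_nonneg_right hlog hδ
      have h3 : δ / ((n : ℝ) + 1) = 1 / (n + 1) * δ := by ring
      linarith
    have hs : cesaroA δ (n + 1) = (1 + δ / (n + 1)) * cesaroA δ n := by
      apply mul_left_cancel₀ hn1.ne'
      rw [h]
      field_simp
    have hc : (((n + 1 : ℕ) : ℝ)) ^ δ = (((n : ℝ) + 1) / n) ^ δ * (n : ℝ) ^ δ := by
      rw [← Real.mul_rpow (by positivity) hn0.le]
      congr 1
      push_cast
      field_simp
    rw [hs, hc]
    calc _ ≤ (((n : ℝ) + 1) / n) ^ δ * ((1 + δ) * (n : ℝ) ^ δ) := by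
          gcongr
          exact (cesaroA_pos (by linarith) n).le
      _ = _ := by ring

/-- The `ℓ¹` norm of the coefficient sequence of `f` is at most `K`. -/
def L1NormLE (f : PowerSeries ℝ) (K : ℝ) : Prop :=
  ∀ N, ∑ m ∈ range N, |coeff m f| ≤ K

lemma L1NormLE.nonneg {f : PowerSeries ℝ} {K : ℝ} (h : L1NormLE f K) : 0 ≤ K := by
  simpa using h 0

lemma L1NormLE.mono {f : PowerSeries ℝ} {K L : ℝ} (h : L1NormLE f K) (hKL : K ≤ L) :
    L1NormLE f L := fun N => (h N).trans hKL

lemma L1NormLE.add {f g : PowerSeries ℝ} {K L : ℝ} (hf : L1NormLE f K) (hg : L1NormLE g L) :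
    L1NormLE (f + g) (K + L) := fun N => by
  refine le_trans ?_ (add_le_add (hf N) (hg N))
  rw [← sum_add_distrib]
  exact sum_le_sum fun m _ => by rw [map_add]; exact abs_add_le _ _

lemma L1NormLE.X_mul {f : PowerSeries ℝ} {K : ℝ} (hf : L1NormLE f K) :
    L1NormLE (X * f) K := fun N => by
  cases N with
  | zero => simpa using hf.nonneg
  | succ N =>
    rw [sum_range_succ']
    simpa [coeff_succ_X_mul] using hf N

lemma L1NormLE.C_mul {f : PowerSeries ℝ} {K : ℝ} (hf : L1NormLE f K) (c : ℝ) :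
    L1NormLE (C c * f) (|c| * K) := fun N => by
  simp only [coeff_C_mul, abs_mul, ← mul_sum]
  exact mul_le_mul_of_nonneg_left (hf N) (abs_nonneg c)

lemma L1NormLE.mul {f g : PowerSeries ℝ} {K L : ℝ} (hf : L1NormLE f K) (hg : L1NormLE g L) :
    L1NormLE (f * g) (K * L) := fun N => by
  calc ∑ m ∈ range N, |coeff m (f * g)|
      ≤ ∑ m ∈ range N, ∑ p ∈ antidiagonal m, |coeff p.1 f| * |coeff p.2 g| := by
        refine sum_le_sum fun m _ => ?_
        rw [coeff_mul]
        refine (abs_sum_le_sum_abs _ _).trans (le_of_eq ?_)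
        simp [abs_mul]
    _ = ∑ q ∈ (range N).sigma (fun m => antidiagonal m), |coeff q.2.1 f| * |coeff q.2.2 g| := by
        rw [sum_sigma]
    _ = ∑ p ∈ ((range N).sigma (fun m => antidiagonal m)).image (fun q => q.2),
          |coeff p.1 f| * |coeff p.2 g| := by
        rw [sum_image]
        rintro ⟨m, p⟩ hp ⟨m', p'⟩ hp' h
        simp only [coe_sigma, Set.mem_sigma_iff, mem_coe, HasAntidiagonal.mem_antidiagonal] at hp hp' h
        obtain rfl := h
        obtain rfl : m = m' := hp.2.symm.trans hp'.2
        rfl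
    _ ≤ ∑ p ∈ range N ×ˢ range N, |coeff p.1 f| * |coeff p.2 g| := by
        refine sum_le_sum_of_subset_of_nonneg ?_ fun _ _ _ => by positivity
        intro p hp
        simp only [mem_image, mem_sigma, mem_range, HasAntidiagonal.mem_antidiagonal] at hp
        obtain ⟨⟨m, q⟩, ⟨hm, hq⟩, rfl⟩ := hp
        simp only [mem_product, mem_range]
        dsimp only at hm hq ⊢
        omega
    _ = (∑ i ∈ range N, |coeff i f|) * ∑ j ∈ range N, |coeff j g| := by
        rw [sum_mul_sum, sum_product]
    _ ≤ K * L := mul_le_mul (hf N) (hg N) (sum_nonneg fun _ _ => abs_nonneg _) hf.nonneg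

lemma exists_L1NormLE_oneSubRpow {r : ℝ} (hr : 0 < r) : ∃ K, L1NormLE (oneSubRpow r) K := by
  set e : ℕ → ℝ := fun k => |coeff k (oneSubRpow r)| with he
  have e_nonneg (k : ℕ) : 0 ≤ e k := abs_nonneg _
  set k₀ := ⌈r⌉₊
  have htel : ∀ n, r * ∑ k ∈ range n, e (k₀ + k) ≤ k₀ * e k₀ - (k₀ + n) * e (k₀ + n) := by
    intro n
    induction n with
    | zero => simp
    | succ n ih =>
      have hk : r ≤ ((k₀ + n : ℕ) : ℝ) := (Nat.le_ceil r).trans (by push_cast; simp [k₀])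
      have h := congrArg abs (coeff_succ_oneSubRpow r (k₀ + n))
      rw [abs_mul, abs_mul, abs_of_pos (by positivity : (0 : ℝ) < ((k₀ + n : ℕ) : ℝ) + 1),
        abs_of_nonneg (sub_nonneg.2 hk)] at h
      rw [sum_range_succ]
      push_cast at h ⊢
      rw [← add_assoc k₀ n 1, ← add_assoc (k₀ : ℝ) n 1]
      simp only [he] at ih ⊢
      linarith
  refine ⟨∑ k ∈ range k₀, e k + k₀ * e k₀ / r, fun N => ?_⟩
  calc ∑ m ∈ range N, e m ≤ ∑ m ∈ range (k₀ + N), e m :=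
        sum_le_sum_of_subset_of_nonneg (range_mono (by omega)) fun _ _ _ => e_nonneg _
    _ = ∑ k ∈ range k₀, e k + ∑ k ∈ range N, e (k₀ + k) := sum_range_add _ _ _
    _ ≤ _ := by
        have h1 : 0 ≤ ((k₀ : ℝ) + N) * e (k₀ + N) := mul_nonneg (by positivity) (e_nonneg _)
        have h2 := htel N
        gcongr
        rw [le_div_iff₀ hr]
        linarith

/-- The power series with coefficients `(m + t) ^ s`. -/
noncomputable def shiftedPowSeries (s t : ℝ) : PowerSeries ℝ := mk fun m => ((m : ℝ) + t) ^ s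

lemma Gamma_mul_cesaroA_mem_Icc {s : ℝ} (hs : -1 < s) (hs0 : s ≤ 0) {m : ℕ} (hm : 1 ≤ m) :
    Real.Gamma (s + 1) * cesaroA s m ∈ Set.Icc (((m : ℝ) + 1) ^ s) ((m : ℝ) ^ s) := by
  have hm0 : (0 : ℝ) < m := by exact_mod_cast hm
  have hΓ : 0 < Real.Gamma (s + 1) := Real.Gamma_pos_of_pos (by linarith)
  have hΓm : 0 < Real.Gamma (m : ℝ) := Real.Gamma_pos_of_pos hm0
  have hΓm1 : 0 < Real.Gamma ((m : ℝ) + 1) := Real.Gamma_pos_of_pos (by linarith)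
  have hΓs : 0 < Real.Gamma ((m : ℝ) + s + 1) := Real.Gamma_pos_of_pos (by linarith)
  have he : Real.Gamma (s + 1) * cesaroA s m
      = Real.Gamma ((m : ℝ) + s + 1) / Real.Gamma ((m : ℝ) + 1) := by
    unfold cesaroA
    field_simp
  rw [he]
  rcases hs0.eq_or_lt with rfl | hs0
  · simp [hΓm1.ne']
  constructor
  · have h := Real.Gamma_mul_add_mul_le_rpow_Gamma_mul_rpow_Gamma
      (s := (m : ℝ) + s + 1) (t := m + s + 1 + 1) (a := 1 + s) (b := -s)
      (by linarith) (by linarith) (by linarith) (by linarith) (by ring)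
    rw [Real.Gamma_add_one (by linarith : (m : ℝ) + s + 1 ≠ 0),
      Real.mul_rpow (by linarith) hΓs.le, mul_left_comm, ← Real.rpow_add hΓs,
      show (1 + s) * ((m : ℝ) + s + 1) + -s * (m + s + 1 + 1) = m + 1 by ring,
      show 1 + s + -s = 1 by ring, Real.rpow_one] at h
    have h2 : ((m : ℝ) + s + 1) ^ (-s) ≤ ((m : ℝ) + 1) ^ (-s) :=
      Real.rpow_le_rpow (by linarith) (by linarith) (by linarith)
    have h3 : ((m : ℝ) + 1) ^ s * ((m : ℝ) + 1) ^ (-s) = 1 := by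
      rw [← Real.rpow_add (by linarith)]
      simp
    have h4 : 0 < ((m : ℝ) + 1) ^ s := by positivity
    rw [le_div_iff₀ hΓm1]
    calc ((m : ℝ) + 1) ^ s * Real.Gamma (m + 1)
        ≤ ((m : ℝ) + 1) ^ s * (((m : ℝ) + 1) ^ (-s) * Real.Gamma (m + s + 1)) := by
          gcongr
          exact h.trans (by gcongr)
      _ = Real.Gamma (m + s + 1) := by rw [← mul_assoc, h3, one_mul]
  · have h := Real.Gamma_mul_add_mul_le_rpow_Gamma_mul_rpow_Gamma
      (s := (m : ℝ)) (t := m + 1) (a := -s) (b := 1 + s)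
      hm0 (by linarith) (by linarith) (by linarith) (by ring)
    rw [show -s * (m : ℝ) + (1 + s) * (m + 1) = m + s + 1 by ring, Real.Gamma_add_one hm0.ne',
      Real.mul_rpow hm0.le hΓm.le, mul_left_comm, ← Real.rpow_add hΓm,
      show -s + (1 + s) = 1 by ring, Real.rpow_one, Real.rpow_add hm0, Real.rpow_one] at h
    rw [div_le_iff₀ hΓm1, Real.Gamma_add_one hm0.ne']
    linarith

lemma sum_range_sub_shift_le {g : ℕ → ℝ} (hg0 : ∀ m, 0 ≤ g m) (hg1 : ∀ m, g m ≤ 1) (L N : ℕ) :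
    ∑ m ∈ range N, (g m - g (m + L)) ≤ L := by
  induction L with
  | zero => simp
  | succ L ih =>
    have h : ∑ m ∈ range N, (g (m + L) - g (m + L + 1)) = g L - g (N + L) := by
      have := sum_range_sub' (fun m => g (m + L)) N
      simp only [zero_add] at this
      rw [← this]
      exact sum_congr rfl fun m _ => by rw [add_right_comm]
    have h2 : ∑ m ∈ range N, (g m - g (m + (L + 1)))
        = ∑ m ∈ range N, (g m - g (m + L)) + ∑ m ∈ range N, (g (m + L) - g (m + L + 1)) := by
      rw [← sum_add_distrib]
      exact sum_congr rfl fun m _ => by rw [← add_assoc]; ring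
    rw [h2, h]
    push_cast
    linarith [hg1 L, hg0 (N + L)]

lemma exists_L1NormLE_of_nonpos {s : ℝ} (hs : -1 < s) (hs0 : s ≤ 0) (L : ℕ) :
    ∃ K, ∀ t ∈ Set.Icc (1 : ℝ) L, L1NormLE (oneSubRpow (s + 1) * shiftedPowSeries s t) K := by
  obtain ⟨K, hK⟩ := exists_L1NormLE_oneSubRpow (by linarith : 0 < s + 1)
  have hΓ : 0 < Real.Gamma (s + 1) := Real.Gamma_pos_of_pos (by linarith)
  have hone : L1NormLE 1 1 := fun N => by
    cases N <;> simp [coeff_one, sum_range_succ', abs_of_nonneg]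
  refine ⟨|Real.Gamma (s + 1)| * 1 + K * (L + (1 + Real.Gamma (s + 1))), fun t ht => ?_⟩
  have ht0 : 0 < t := by linarith [ht.1]
  set D : PowerSeries ℝ :=
    mk fun m => ((m : ℝ) + t) ^ s - Real.Gamma (s + 1) * cesaroA s m with hD
  have hsplit : oneSubRpow (s + 1) * shiftedPowSeries s t
      = C (Real.Gamma (s + 1)) * 1 + oneSubRpow (s + 1) * D := by
    have h1 : shiftedPowSeries s t = C (Real.Gamma (s + 1)) * oneSubRpow (-s - 1) + D := by
      ext m
      simp [shiftedPowSeries, hD, coeff_C_mul, coeff_oneSubRpow_eq_cesaroA hs]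
    have h2 : oneSubRpow (s + 1) * oneSubRpow (-s - 1) = 1 := by
      rw [← oneSubRpow_add, show s + 1 + (-s - 1) = 0 by ring, oneSubRpow_zero]
    rw [h1, mul_add, mul_left_comm, h2]
  rw [hsplit]
  refine (hone.C_mul _).add (hK.mul fun N => ?_)
  cases N with
  | zero => simp; positivity
  | succ N =>
    rw [sum_range_succ']
    refine add_le_add (le_trans (sum_le_sum fun m _ => ?_) (sum_range_sub_shift_le
      (g := fun m => ((m : ℝ) + 1) ^ s) (fun m => by positivity) (fun m => ?_) L N)) ?_
    · obtain ⟨h1, h2⟩ := Gamma_mul_cesaroA_mem_Icc hs hs0 (Nat.le_add_left 1 m)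
      have h3 : ((m : ℝ) + 1 + t) ^ s ≤ ((m : ℝ) + 1 + 1) ^ s :=
        Real.rpow_le_rpow_of_nonpos (by positivity) (by linarith [ht.1]) hs0
      have h4 : ((m : ℝ) + L + 1) ^ s ≤ ((m : ℝ) + 1 + t) ^ s :=
        Real.rpow_le_rpow_of_nonpos (by positivity) (by linarith [ht.2]) hs0
      have h5 : ((m : ℝ) + 1 + 1) ^ s ≤ ((m : ℝ) + 1) ^ s :=
        Real.rpow_le_rpow_of_nonpos (by positivity) (by linarith) hs0
      simp only [hD, coeff_mk]
      push_cast at h1 h2 ⊢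
      rw [abs_le]
      constructor <;> linarith
    · exact Real.rpow_le_one_of_one_le_of_nonpos (by simp) hs0
    · have h1 : t ^ s ≤ 1 := Real.rpow_le_one_of_one_le_of_nonpos ht.1 hs0
      have h2 : 0 < t ^ s := by positivity
      simp only [hD, coeff_mk, cesaroA_zero hs, Nat.cast_zero, zero_add, mul_one]
      rw [abs_le]
      constructor <;> linarith

lemma shiftedPowSeries_eq (s t : ℝ) :
    shiftedPowSeries s t = C (t ^ s) + X * shiftedPowSeries s (t + 1) := by
  ext m
  cases m with
  | zero => simp [shiftedPowSeries]
  | succ m =>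
    rw [map_add, coeff_succ_X_mul, coeff_C]
    simp [shiftedPowSeries, add_assoc, add_comm t]

lemma integral_coeff_mul_shiftedPowSeries {s t : ℝ} (hs : 0 < s) (ht : 1 ≤ t)
    (f : PowerSeries ℝ) (m : ℕ) :
    coeff m (f * (shiftedPowSeries s (t + 1) - shiftedPowSeries s t))
      = s * ∫ u in (0 : ℝ)..1, coeff m (f * shiftedPowSeries (s - 1) (t + u)) := by
  have h_intervalIntegrable : ∀ j : ℕ, IntervalIntegrable (fun u : ℝ => ((j : ℝ) + (t + u)) ^ (s - 1))
      MeasureTheory.volume 0 1 := fun j => by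
    refine ContinuousOn.intervalIntegrable (ContinuousOn.rpow_const (by fun_prop) fun u hu => ?_)
    rw [Set.uIcc_of_le zero_le_one] at hu
    have hj : (0 : ℝ) ≤ j := j.cast_nonneg
    exact Or.inl (by linarith [hu.1])
  simp only [coeff_mul, shiftedPowSeries, coeff_mk, map_sub]
  rw [intervalIntegral.integral_finsetSum fun p _ => (h_intervalIntegrable p.2).const_mul _, mul_sum]
  refine sum_congr rfl fun p _ => ?_
  rw [intervalIntegral.integral_const_mul]
  simp_rw [← add_assoc]
  rw [intervalIntegral.integral_comp_add_left (fun x : ℝ => x ^ (s - 1)) ((p.2 : ℝ) + t),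
    integral_rpow (Or.inl (by linarith)), sub_add_cancel, add_zero]
  field_simp

lemma continuousOn_coeff_mul_shiftedPowSeries (s : ℝ) {t : ℝ} (ht : 1 ≤ t)
    (f : PowerSeries ℝ) (m : ℕ) :
    ContinuousOn (fun u : ℝ => coeff m (f * shiftedPowSeries s (t + u))) (Set.Icc 0 1) := by
  simp only [coeff_mul, shiftedPowSeries, coeff_mk]
  refine continuousOn_finsetSum _ fun p _ => continuousOn_const.mul ?_
  refine ContinuousOn.rpow_const (by fun_prop) fun u hu => Or.inl ?_
  have hj : (0 : ℝ) ≤ p.2 := p.2.cast_nonneg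
  linarith [hu.1]

lemma exists_L1NormLE_of_pos {s : ℝ} (hs : 0 < s) (L : ℕ)
    (h : ∃ K, ∀ t ∈ Set.Icc (1 : ℝ) (L + 1 : ℕ),
      L1NormLE (oneSubRpow s * shiftedPowSeries (s - 1) t) K) :
    ∃ K, ∀ t ∈ Set.Icc (1 : ℝ) L, L1NormLE (oneSubRpow (s + 1) * shiftedPowSeries s t) K := by
  obtain ⟨K, hK⟩ := h
  obtain ⟨K', hK'⟩ := exists_L1NormLE_oneSubRpow hs
  refine ⟨(L : ℝ) ^ s * K' + s * K, fun t ht => ?_⟩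
  have ht0 : 0 < t := by linarith [ht.1]
  have hsplit : oneSubRpow (s + 1) * shiftedPowSeries s t
      = C (t ^ s) * oneSubRpow s
        + X * (oneSubRpow s * (shiftedPowSeries s (t + 1) - shiftedPowSeries s t)) := by
    rw [oneSubRpow_add, oneSubRpow_one]
    linear_combination oneSubRpow s * shiftedPowSeries_eq s t
  rw [hsplit]
  refine L1NormLE.add ((hK'.C_mul _).mono ?_) (L1NormLE.X_mul fun N => ?_)
  · rw [abs_of_pos (by positivity)]
    exact mul_le_mul_of_nonneg_right (Real.rpow_le_rpow ht0.le ht.2 hs.le) hK'.nonneg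
  have hcont (m : ℕ) := continuousOn_coeff_mul_shiftedPowSeries (s - 1) ht.1 (oneSubRpow s) m
  have h_intervalIntegrable (m : ℕ) : IntervalIntegrable
      (fun u => |coeff m (oneSubRpow s * shiftedPowSeries (s - 1) (t + u))|)
      MeasureTheory.volume 0 1 := by
    refine ContinuousOn.intervalIntegrable ?_
    rw [Set.uIcc_of_le zero_le_one]
    exact (hcont m).abs
  have hsum : IntervalIntegrable
      (fun u => ∑ m ∈ range N, |coeff m (oneSubRpow s * shiftedPowSeries (s - 1) (t + u))|)
      MeasureTheory.volume 0 1 := by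
    simpa only [Finset.sum_fn] using IntervalIntegrable.sum (range N) fun m _ => h_intervalIntegrable m
  calc _ ≤ ∑ m ∈ range N, s * ∫ u in (0 : ℝ)..1,
          |coeff m (oneSubRpow s * shiftedPowSeries (s - 1) (t + u))| := by
        refine sum_le_sum fun m _ => ?_
        rw [integral_coeff_mul_shiftedPowSeries hs ht.1, abs_mul, abs_of_pos hs]
        gcongr
        exact intervalIntegral.abs_integral_le_integral_abs zero_le_one
    _ = s * ∫ u in (0 : ℝ)..1, ∑ m ∈ range N,
          |coeff m (oneSubRpow s * shiftedPowSeries (s - 1) (t + u))| := by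
        rw [intervalIntegral.integral_finsetSum fun m _ => h_intervalIntegrable m, mul_sum]
    _ ≤ s * ∫ u in (0 : ℝ)..1, K := by
        gcongr
        refine intervalIntegral.integral_mono_on zero_le_one
          hsum (by simp)
          fun u hu => hK (t + u) ⟨by linarith [ht.1, hu.1], ?_⟩ N
        push_cast
        linarith [ht.2, hu.2]
    _ = s * K := by simp

lemma exists_L1NormLE_mul_shiftedPowSeries {s : ℝ} (hs : -1 < s) (L : ℕ) :
    ∃ K, ∀ t ∈ Set.Icc (1 : ℝ) L, L1NormLE (oneSubRpow (s + 1) * shiftedPowSeries s t) K := by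
  obtain ⟨n, hn⟩ := exists_nat_ge s
  induction n generalizing s L with
  | zero => exact exists_L1NormLE_of_nonpos hs (by simpa using hn) L
  | succ n ih =>
    rcases le_or_gt s 0 with hs0 | hs0
    · exact exists_L1NormLE_of_nonpos hs hs0 L
    · refine exists_L1NormLE_of_pos hs0 L ?_
      have := ih (s := s - 1) (by linarith) (L + 1) (by push_cast at hn; linarith)
      simpa only [sub_add_cancel] using this

lemma exists_L1NormLE_mul_shiftedPowSeries_Ioc {δ : ℝ} (hδ : 0 < δ) :
    ∃ K, ∀ θ ∈ Set.Ioc (0 : ℝ) 1, L1NormLE (oneSubRpow (δ + 1) * shiftedPowSeries δ θ) K := by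
  obtain ⟨K, hK⟩ := exists_L1NormLE_mul_shiftedPowSeries (by linarith : -1 < δ) 2
  obtain ⟨K', hK'⟩ := exists_L1NormLE_oneSubRpow (by linarith : 0 < δ + 1)
  refine ⟨K' + K, fun θ hθ => ?_⟩
  have hθ1 : θ ^ δ ≤ 1 := Real.rpow_le_one hθ.1.le hθ.2 hδ.le
  have hθ0 : 0 ≤ θ ^ δ := Real.rpow_nonneg hθ.1.le δ
  rw [shiftedPowSeries_eq, mul_add, mul_comm _ (C _), mul_left_comm _ X]
  refine ((hK'.C_mul _).mono ?_).add (hK (θ + 1) ⟨?_, ?_⟩).X_mul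
  · rw [abs_of_nonneg hθ0]
    exact mul_le_of_le_one_left hK'.nonneg hθ1
  · linarith [hθ.1]
  · push_cast
    linarith [hθ.2]

lemma coeff_oneSubRpow_mul_mk {δ : ℝ} (hδ : -1 < δ) (a : ℕ → ℝ) (n : ℕ) :
    coeff n (oneSubRpow (-δ - 1) * mk a) = cesaroA δ n * cesaroMean δ a n := by
  rw [cesaroMean, ← mul_assoc, mul_one_div_cancel (cesaroA_pos hδ n).ne', one_mul, mul_comm,
    coeff_mul, Nat.sum_antidiagonal_eq_sum_range_succ_mk]
  exact sum_congr rfl fun k _ => by rw [coeff_mk, coeff_oneSubRpow_eq_cesaroA hδ, mul_comm]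

lemma rpow_mul_rieszMean (δ : ℝ) (a : ℕ → ℝ) (n : ℕ) {θ : ℝ} (hθ : θ ∈ Set.Ioc (0 : ℝ) 1) :
    ((n : ℝ) + θ) ^ δ * rieszMean δ a (n + θ) = coeff n (shiftedPowSeries δ θ * mk a) := by
  have hR : 0 < (n : ℝ) + θ := by linarith [hθ.1, (n.cast_nonneg : (0 : ℝ) ≤ n)]
  have hceil : ⌈(n : ℝ) + θ⌉₊ = n + 1 := by
    rw [Nat.ceil_eq_iff (by omega)]
    push_cast
    constructor <;> linarith [hθ.1, hθ.2]
  rw [rieszMean, hceil, mul_comm (shiftedPowSeries δ θ), coeff_mul,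
    Nat.sum_antidiagonal_eq_sum_range_succ_mk, mul_sum]
  refine sum_congr rfl fun k hk => ?_
  have hkn : k ≤ n := by simpa [Nat.lt_succ_iff] using hk
  have hkn' : (k : ℝ) ≤ n := by exact_mod_cast hkn
  rw [if_pos (by linarith [hθ.1]), coeff_mk, shiftedPowSeries, coeff_mk, Nat.cast_sub hkn,
    ← mul_assoc, mul_comm (a k), one_sub_div hR.ne', ← Real.mul_rpow hR.le
      (div_nonneg (by linarith [hθ.1]) hR.le), mul_div_cancel₀ _ hR.ne']
  congr 2
  ring

lemma exists_abs_rieszMean_le {δ : ℝ} (hδ : 0 < δ) :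
    ∃ C > (0 : ℝ), ∀ (a : ℕ → ℝ) (M : ℝ), (∀ N, |cesaroMean δ a N| ≤ M) →
      ∀ R > 0, |rieszMean δ a R| ≤ C * M := by
  obtain ⟨K, hK⟩ := exists_L1NormLE_mul_shiftedPowSeries_Ioc hδ
  have hK0 : 0 ≤ K := (hK 1 (by simp)).nonneg
  have hδ1 : -1 < δ := by linarith
  refine ⟨(K + 1) * (1 + δ), by positivity, fun a M hM R hR => ?_⟩
  have hM0 : 0 ≤ M := (abs_nonneg _).trans (hM 0)
  obtain ⟨n, θ, hθ, rfl⟩ : ∃ (n : ℕ) (θ : ℝ), θ ∈ Set.Ioc (0 : ℝ) 1 ∧ R = n + θ := by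
    have hc : 1 ≤ ⌈R⌉₊ := Nat.ceil_pos.2 hR
    refine ⟨⌈R⌉₊ - 1, R - (⌈R⌉₊ - 1 : ℕ), ⟨?_, ?_⟩, by ring⟩ <;> rw [Nat.cast_sub hc]
    · linarith [Nat.ceil_lt_add_one hR.le, (Nat.cast_one : ((1 : ℕ) : ℝ) = 1)]
    · linarith [Nat.le_ceil R, (Nat.cast_one : ((1 : ℕ) : ℝ) = 1)]
  rcases Nat.eq_zero_or_pos n with rfl | hn
  · have hceil : ⌈θ⌉₊ = 1 := by
      rw [Nat.ceil_eq_iff (by omega)]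
      simpa using hθ
    have h0 : rieszMean δ a ((0 : ℕ) + θ) = cesaroMean δ a 0 := by
      simp [rieszMean, cesaroMean, hceil, hθ.1, cesaroA_zero hδ1]
    rw [h0]
    exact (hM 0).trans (le_mul_of_one_le_left hM0 (by nlinarith))
  have hn0 : (0 : ℝ) < n := by exact_mod_cast hn
  have hRn : (n : ℝ) ^ δ ≤ ((n : ℝ) + θ) ^ δ :=
    Real.rpow_le_rpow hn0.le (by linarith [hθ.1]) hδ.le
  have hpos : 0 < ((n : ℝ) + θ) ^ δ := by positivity
  have hfac : shiftedPowSeries δ θ * mk a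
      = oneSubRpow (δ + 1) * shiftedPowSeries δ θ * (oneSubRpow (-δ - 1) * mk a) := by
    have h : oneSubRpow (δ + 1) * oneSubRpow (-δ - 1) = 1 := by
      rw [← oneSubRpow_add, show δ + 1 + (-δ - 1) = 0 by ring, oneSubRpow_zero]
    linear_combination -(shiftedPowSeries δ θ * mk a) * h
  have key : |coeff n (shiftedPowSeries δ θ * mk a)| ≤ K * (cesaroA δ n * M) := by
    rw [hfac, coeff_mul, Nat.sum_antidiagonal_eq_sum_range_succ_mk]
    calc _ ≤ ∑ k ∈ range (n + 1), |coeff k (oneSubRpow (δ + 1) * shiftedPowSeries δ θ)|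
            * (cesaroA δ n * M) := by
          refine (abs_sum_le_sum_abs _ _).trans (sum_le_sum fun k _ => ?_)
          rw [coeff_oneSubRpow_mul_mk hδ1, abs_mul, abs_mul, abs_of_pos (cesaroA_pos hδ1 _)]
          gcongr
          · exact (cesaroA_pos hδ1 n).le
          · exact cesaroA_monotone hδ.le (Nat.sub_le n k)
          · exact hM _
      _ ≤ _ := by
          rw [← sum_mul]
          exact mul_le_mul_of_nonneg_right (hK θ hθ _)
            (mul_nonneg (cesaroA_pos hδ1 n).le hM0)
  rw [← rpow_mul_rieszMean δ a n hθ, abs_mul, abs_of_pos hpos] at key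
  refine le_of_mul_le_mul_left (key.trans ?_) hpos
  calc K * (cesaroA δ n * M) ≤ (K + 1) * ((1 + δ) * ((n : ℝ) + θ) ^ δ * M) := by
        gcongr
        · exact mul_nonneg (cesaroA_pos hδ1 n).le hM0
        · linarith
        · exact (cesaroA_le_rpow hδ.le hn).trans (by gcongr)
    _ = _ := by ring

end

theorem stmt_14 (δ : ℝ) (hδ : 0 < δ) :
    ∃ C > (0 : ℝ), ∀ a : ℕ → ℝ,
      (⨆ (R : ℝ) (_ : 0 < R), ENNReal.ofReal |rieszMean δ a R|) ≤
        ENNReal.ofReal C * (⨆ N : ℕ, ENNReal.ofReal |cesaroMean δ a N|) +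
          ENNReal.ofReal C * ⨆ k : ℕ, ENNReal.ofReal (|a k| / ((k : ℝ) + 1) ^ δ) := by
  obtain ⟨C, hC, h⟩ := exists_abs_rieszMean_le hδ
  refine ⟨C, hC, fun a => le_add_right (iSup₂_le fun R hR => ?_)⟩
  set S := ⨆ N : ℕ, ENNReal.ofReal |cesaroMean δ a N|
  by_cases hT : S = ⊤
  · rw [hT, ENNReal.mul_top (by simpa using hC)]
    exact le_top
  have hM : ∀ N, |cesaroMean δ a N| ≤ S.toReal := fun N =>
    (ENNReal.ofReal_le_iff_le_toReal hT).1 (le_iSup (fun N => ENNReal.ofReal |cesaroMean δ a N|) N)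
  calc ENNReal.ofReal |rieszMean δ a R| ≤ ENNReal.ofReal (C * S.toReal) :=
        ENNReal.ofReal_le_ofReal (h a _ hM R hR)
    _ = ENNReal.ofReal C * S := by rw [ENNReal.ofReal_mul hC.le, ENNReal.ofReal_toReal hT]
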